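/- arXiv:2307.12444 — 3 statements merged into one kernel-verified Lean document; each statement's English description precedes it below -/
import Mathlib

section
/- Let (Ω, 𝒜, μ) be a finite measure space and let u, v : Ω → ℝ be measurable with u ≥ 0 and v ≥ 0 a.e. Assume the functions x ↦ s(u(x)) and x ↦ s(v(x)) are integrable and that u and v are not a.e. equal. Then for every t ∈ (0,1), the function x ↦ s(t·u(x) + (1−t)·v(x)) is integrable and ∫ s(t·u + (1−t)·v) dμ < t·∫ s(u) dμ + (1−t)·∫ s(v) dμ. (Strict convexity of the negative entropy functional on nonnegative functions.) -/
open MeasureTheory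

/-- Strict convexity of the negative entropy functional `u ↦ ∫ (u log u − u) dμ` on the
cone of a.e.-nonnegative functions, over a finite measure space. -/
theorem negEntropy_strictConvex
    {Ω : Type*} [MeasurableSpace Ω] (μ : Measure Ω) [IsFiniteMeasure μ]
    (u v : Ω → ℝ) (hum : Measurable u) (hvm : Measurable v)
    (hu0 : ∀ᵐ x ∂μ, 0 ≤ u x) (hv0 : ∀ᵐ x ∂μ, 0 ≤ v x)
    (hui : Integrable (fun x => u x * Real.log (u x) - u x) μ)
    (hvi : Integrable (fun x => v x * Real.log (v x) - v x) μ)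
    (hne : ¬ u =ᵐ[μ] v) :
    ∀ t : ℝ, t ∈ Set.Ioo (0 : ℝ) 1 →
      Integrable (fun x =>
        (t * u x + (1 - t) * v x) * Real.log (t * u x + (1 - t) * v x)
          - (t * u x + (1 - t) * v x)) μ ∧
      ∫ x, ((t * u x + (1 - t) * v x) * Real.log (t * u x + (1 - t) * v x)
          - (t * u x + (1 - t) * v x)) ∂μ <
        t * ∫ x, (u x * Real.log (u x) - u x) ∂μ
          + (1 - t) * ∫ x, (v x * Real.log (v x) - v x) ∂μ := by
  intro t ht
  obtain ⟨ht0, ht1⟩ := ht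
  have hlow : ∀ x : ℝ, 0 ≤ x → -1 ≤ x * Real.log x - x := by
    intro x hx
    rcases hx.eq_or_lt with h | h
    · subst h; norm_num
    · have h1 := Real.one_sub_inv_le_log_of_pos h
      have h2 := mul_le_mul_of_nonneg_left h1 hx
      have h3 : x * (1 - x⁻¹) = x - 1 := by field_simp
      linarith
  have hle : ∀ a b : ℝ, 0 ≤ a → 0 ≤ b →
      (t * a + (1 - t) * b) * Real.log (t * a + (1 - t) * b) - (t * a + (1 - t) * b)
        ≤ t * (a * Real.log a - a) + (1 - t) * (b * Real.log b - b) := by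
    intro a b ha hb
    have h := Real.strictConvexOn_mul_log.convexOn.2 (Set.mem_Ici.2 ha) (Set.mem_Ici.2 hb)
      ht0.le (sub_pos.2 ht1).le (by ring)
    simp only [smul_eq_mul] at h
    linarith
  have hlt : ∀ a b : ℝ, 0 ≤ a → 0 ≤ b → a ≠ b →
      (t * a + (1 - t) * b) * Real.log (t * a + (1 - t) * b) - (t * a + (1 - t) * b)
        < t * (a * Real.log a - a) + (1 - t) * (b * Real.log b - b) := by
    intro a b ha hb hab
    have h := Real.strictConvexOn_mul_log.2 (Set.mem_Ici.2 ha) (Set.mem_Ici.2 hb) hab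
      ht0 (sub_pos.2 ht1) (by ring)
    simp only [smul_eq_mul] at h
    linarith
  have hR : Integrable (fun x => t * (u x * Real.log (u x) - u x)
      + (1 - t) * (v x * Real.log (v x) - v x)) μ :=
    (hui.const_mul t).add (hvi.const_mul (1 - t))
  have hL : Integrable (fun x =>
        (t * u x + (1 - t) * v x) * Real.log (t * u x + (1 - t) * v x)
          - (t * u x + (1 - t) * v x)) μ := by
    refine (hR.abs.add (integrable_const (1 : ℝ))).mono' ?_ ?_
    · exact Measurable.aestronglyMeasurable (by fun_prop)
    · filter_upwards [hu0, hv0] with x hx hy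
      have h1 := hle _ _ hx hy
      have h2 := hlow (t * u x + (1 - t) * v x)
        (add_nonneg (mul_nonneg ht0.le hx) (mul_nonneg (sub_pos.2 ht1).le hy))
      simp only [Pi.add_apply, Real.norm_eq_abs]
      have h3 := le_abs_self (t * (u x * Real.log (u x) - u x)
        + (1 - t) * (v x * Real.log (v x) - v x))
      have h4 := abs_nonneg (t * (u x * Real.log (u x) - u x)
        + (1 - t) * (v x * Real.log (v x) - v x))
      exact abs_le.2 ⟨by linarith, by linarith⟩
  refine ⟨hL, ?_⟩
  have hae : (fun x =>
        (t * u x + (1 - t) * v x) * Real.log (t * u x + (1 - t) * v x)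
          - (t * u x + (1 - t) * v x)) ≤ᵐ[μ] (fun x => t * (u x * Real.log (u x) - u x)
      + (1 - t) * (v x * Real.log (v x) - v x)) := by
    filter_upwards [hu0, hv0] with x hx hy using hle _ _ hx hy
  rw [← integral_const_mul, ← integral_const_mul,
    ← integral_add (hui.const_mul t) (hvi.const_mul (1 - t))]
  refine lt_of_le_of_ne (integral_mono_ae hL hR hae) fun heq => hne ?_
  have h := (integral_eq_iff_of_ae_le hL hR hae).1 heq
  filter_upwards [h, hu0, hv0] with x hx h1 h2
  by_contra hc
  exact (hlt _ _ h1 h2 hc).ne hx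
end

section
/- Let (Ω, 𝒜, μ) be a finite measure space and define S : L^∞(μ) → ℝ by S(f) = ∫ ( f·log f − f ) dμ (using any a.e. representative; the integrand is bounded, hence integrable, for f ∈ L^∞(μ)). Let ε > 0 and u ∈ L^∞(μ) with u ≥ ε a.e. Then there exists a continuous linear functional L : L^∞(μ) → ℝ with L(v) = ∫ v·log u dμ for every v ∈ L^∞(μ), and S is Fréchet differentiable at u (with respect to the L^∞-norm) with derivative L. -/
open MeasureTheory

theorem negEntropy_pointwise (ε a b : ℝ) (hε : 0 < ε) (ha : ε ≤ a) (hb : 0 < b) :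
    |(b * Real.log b - b) - (a * Real.log a - a) - (b - a) * Real.log a| ≤ (b - a) ^ 2 / ε := by
  have ha0 : 0 < a := hε.trans_le ha
  have e : (b * Real.log b - b) - (a * Real.log a - a) - (b - a) * Real.log a
      = b * Real.log (b / a) - (b - a) := by
    rw [Real.log_div hb.ne' ha0.ne']; ring
  rw [e]
  have h1 : b * Real.log (b / a) ≤ b * (b / a - 1) :=
    mul_le_mul_of_nonneg_left (Real.log_le_sub_one_of_pos (div_pos hb ha0)) hb.le
  have h2 : b * (1 - (b / a)⁻¹) ≤ b * Real.log (b / a) :=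
    mul_le_mul_of_nonneg_left (Real.one_sub_inv_le_log_of_pos (div_pos hb ha0)) hb.le
  have h3 : b * (b / a - 1) - (b - a) = (b - a) ^ 2 / a := by field_simp
  have h4 : b * (1 - (b / a)⁻¹) = b - a := by field_simp
  have h5 : (b - a) ^ 2 / a ≤ (b - a) ^ 2 / ε := by gcongr
  rw [abs_of_nonneg (by linarith)]
  linarith

theorem negEntropy_ae_le {Ω : Type*} [MeasurableSpace Ω] (μ : Measure Ω) (f : Lp ℝ ⊤ μ) :
    ∀ᵐ x ∂μ, |f x| ≤ ‖f‖ := by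
  have h := ae_le_eLpNormEssSup (f := f) (μ := μ)
  filter_upwards [h] with x hx
  have hfin := Lp.eLpNorm_ne_top f
  rw [Lp.norm_def, ← Real.norm_eq_abs, ← toReal_enorm]
  apply ENNReal.toReal_mono hfin
  rwa [eLpNorm_exponent_top]

theorem negEntropy_integrable {Ω : Type*} [MeasurableSpace Ω] (μ : Measure Ω) [IsFiniteMeasure μ]
    (f : Lp ℝ ⊤ μ) : Integrable (fun x => f x * Real.log (f x) - f x) μ := by
  have hc : Continuous (fun t : ℝ => t * Real.log t - t) := Real.continuous_mul_log.sub continuous_id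
  obtain ⟨C, hC⟩ := (isCompact_Icc (a := -‖f‖) (b := ‖f‖)).exists_bound_of_continuousOn hc.continuousOn
  refine Integrable.of_bound (hc.comp_aestronglyMeasurable (Lp.aestronglyMeasurable f)) C ?_
  filter_upwards [negEntropy_ae_le μ f] with x hx
  exact hC _ (abs_le.mp hx)

/-- The negative entropy functional `S(f) = ∫ (f log f − f) dμ` on `L^∞(μ)` over a finite
measure space is Fréchet differentiable at any uniformly positive `u`, with derivative
the continuous linear functional `v ↦ ∫ v log u dμ`. -/
theorem negEntropy_hasFDerivAt
    {Ω : Type*} [MeasurableSpace Ω] (μ : Measure Ω) [IsFiniteMeasure μ]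
    (ε : ℝ) (hε : 0 < ε) (u : Lp ℝ ⊤ μ) (huε : ∀ᵐ x ∂μ, ε ≤ u x) :
    ∃ L : Lp ℝ ⊤ μ →L[ℝ] ℝ,
      (∀ v : Lp ℝ ⊤ μ, L v = ∫ x, v x * Real.log (u x) ∂μ) ∧
      HasFDerivAt (fun f : Lp ℝ ⊤ μ => ∫ x, (f x * Real.log (f x) - f x) ∂μ) L u := by
  obtain ⟨K, hK⟩ : ∃ K : ℝ, ∀ᵐ x ∂μ, |Real.log (u x)| ≤ K := by
    refine ⟨|Real.log ε| + ‖u‖, ?_⟩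
    filter_upwards [huε, negEntropy_ae_le μ u] with x h1 h2
    have h3 := Real.log_le_log hε h1
    have h4 := Real.log_le_sub_one_of_pos (hε.trans_le h1)
    have := neg_abs_le (Real.log ε)
    have := abs_nonneg (Real.log ε)
    have := (abs_le.mp h2).2
    have := norm_nonneg u
    exact abs_le.mpr ⟨by linarith, by linarith⟩
  have hmeas : AEStronglyMeasurable (fun x => Real.log (u x)) μ :=
    (Real.measurable_log.comp_aemeasurable (Lp.aestronglyMeasurable u).aemeasurable).aestronglyMeasurable
  have hbd : ∀ v : Lp ℝ ⊤ μ, ∀ᵐ x ∂μ, ‖v x * Real.log (u x)‖ ≤ K * ‖v‖ := by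
    intro v
    filter_upwards [hK, negEntropy_ae_le μ v] with x h1 h2
    rw [Real.norm_eq_abs, abs_mul, mul_comm K]
    gcongr
  have hint : ∀ v : Lp ℝ ⊤ μ, Integrable (fun x => v x * Real.log (u x)) μ := fun v =>
    Integrable.of_bound ((Lp.aestronglyMeasurable v).mul hmeas) _ (hbd v)
  let L0 : Lp ℝ ⊤ μ →ₗ[ℝ] ℝ :=
    { toFun := fun v => ∫ x, v x * Real.log (u x) ∂μ
      map_add' := by
        intro v w
        rw [← integral_add (hint v) (hint w)]
        apply integral_congr_ae
        filter_upwards [Lp.coeFn_add v w] with x hx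
        rw [hx, Pi.add_apply]; ring
      map_smul' := by
        intro c v
        rw [RingHom.id_apply, smul_eq_mul, ← integral_const_mul]
        apply integral_congr_ae
        filter_upwards [Lp.coeFn_smul c v] with x hx
        rw [hx, Pi.smul_apply, smul_eq_mul]; ring }
  let L : Lp ℝ ⊤ μ →L[ℝ] ℝ := L0.mkContinuous (K * μ.real Set.univ) (by
    intro v
    have := norm_integral_le_of_norm_le_const (hbd v)
    calc _ ≤ _ := this
      _ = _ := by ring)
  have hL : ∀ v : Lp ℝ ⊤ μ, L v = ∫ x, v x * Real.log (u x) ∂μ := fun v => rfl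
  refine ⟨L, hL, ?_⟩
  rw [hasFDerivAt_iff_isLittleO_nhds_zero]
  refine Asymptotics.IsBigO.trans_isLittleO (g := fun h : Lp ℝ ⊤ μ => ‖h‖ ^ 2) ?_
    (Asymptotics.isLittleO_norm_pow_id one_lt_two)
  refine Asymptotics.IsBigO.of_bound (μ.real Set.univ / ε) ?_
  filter_upwards [Metric.ball_mem_nhds (0 : Lp ℝ ⊤ μ) hε] with h hh
  rw [mem_ball_zero_iff] at hh
  have hi : Integrable (fun x => ((u + h : Lp ℝ ⊤ μ) x * Real.log ((u + h : Lp ℝ ⊤ μ) x)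
      - (u + h : Lp ℝ ⊤ μ) x) - (u x * Real.log (u x) - u x)) μ :=
    (negEntropy_integrable μ (u + h)).sub (negEntropy_integrable μ u)
  rw [hL, ← integral_sub (negEntropy_integrable μ _) (negEntropy_integrable μ _),
    ← integral_sub hi (hint h)]
  refine (norm_integral_le_of_norm_le_const (C := ‖h‖ ^ 2 / ε) ?_).trans (le_of_eq ?_)
  · filter_upwards [huε, negEntropy_ae_le μ h, Lp.coeFn_add u h] with x h1 h2 h3
    rw [Pi.add_apply] at h3
    have hpos : 0 < (u + h : Lp ℝ ⊤ μ) x := by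
      rw [h3]; linarith [(abs_le.mp h2).1]
    have hp := negEntropy_pointwise ε (u x) _ hε h1 hpos
    have e : (u + h : Lp ℝ ⊤ μ) x - u x = h x := by rw [h3]; ring
    rw [e] at hp
    refine hp.trans ?_
    have : (h x) ^ 2 ≤ ‖h‖ ^ 2 := by rw [← sq_abs]; gcongr
    gcongr
  · rw [Real.norm_of_nonneg (by positivity)]; ring
end

section
/- Descent estimate for the Bregman proximal point iteration: let V be a real normed vector space, W ⊆ V a linear subspace, F, G : V → ℝ with F convex on V, (α_j)_{j≥1} positive reals, and (u_j)_{j≥0} ⊆ V with u_j − u_0 ∈ W for all j. Suppose for each j ≥ 0 that G is Fréchet differentiable at u_j with derivative G'_j, for each j ≥ 1 that F is Fréchet differentiable at u_j with derivative F'_j, and that the optimality condition (G'_j − G'_{j−1})(h) = −α_j · F'_j(h) holds for every h ∈ W and every j ≥ 1. Then for every w ∈ V with w − u_0 ∈ W and every k ≥ 1: D_G(w, u_k; G'_k) + Σ_{j=1}^{k} D_G(u_j, u_{j−1}; G'_{j−1}) + Σ_{j=1}^{k} α_j·(F(u_j) − F(w)) ≤ D_G(w, u_0; G'_0). -/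
/-- The Bregman divergence `D_G(a, b; φ) = G(a) − G(b) − φ(a − b)`, where `φ` plays the
role of the Fréchet derivative of `G` at `b`. -/
def bregmanDiv {V : Type*} [NormedAddCommGroup V] [NormedSpace ℝ V]
    (G : V → ℝ) (a b : V) (φ : V →L[ℝ] ℝ) : ℝ :=
  G a - G b - φ (a - b)

/-- First-order (gradient) inequality for a convex function. -/
theorem convex_gradient_ineq {V : Type*} [NormedAddCommGroup V] [NormedSpace ℝ V]
    {F : V → ℝ} (hF : ConvexOn ℝ Set.univ F) {x : V} {φ : V →L[ℝ] ℝ}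
    (h : HasFDerivAt F φ x) (w : V) : φ (w - x) ≤ F w - F x := by
  have hc : ConvexOn ℝ Set.univ (fun t : ℝ => F (AffineMap.lineMap x w t)) := by
    simpa [Function.comp_def] using hF.comp_affineMap (AffineMap.lineMap (k := ℝ) x w)
  have hd : HasDerivAt (fun t : ℝ => F (AffineMap.lineMap x w t)) (φ (w - x)) 0 := by
    have h0 : HasFDerivAt F φ (AffineMap.lineMap x w (0 : ℝ)) := by simpa using h
    exact h0.comp_hasDerivAt (0 : ℝ) AffineMap.hasDerivAt_lineMap
  have := hc.le_slope_of_hasDerivAt (Set.mem_univ 0) (Set.mem_univ 1) one_pos hd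
  simpa [slope_def_field] using this

/-- Descent estimate for the Bregman proximal point iteration: under the optimality
conditions `(G'_j − G'_{j−1})(h) = −α_j F'_j(h)` for `h` in the subspace `W`, for every
feasible comparison point `w` and every `k ≥ 1`,
`D_G(w, u_k) + Σ_{j=1}^k D_G(u_j, u_{j−1}) + Σ_{j=1}^k α_j (F(u_j) − F(w)) ≤ D_G(w, u_0)`. -/
theorem bregman_proximal_descent
    {V : Type*} [NormedAddCommGroup V] [NormedSpace ℝ V]
    (W : Submodule ℝ V) (F G : V → ℝ) (hF : ConvexOn ℝ Set.univ F)
    (α : ℕ → ℝ) (hα : ∀ j : ℕ, 1 ≤ j → 0 < α j)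
    (u : ℕ → V) (hu : ∀ j : ℕ, u j - u 0 ∈ W)
    (G' : ℕ → (V →L[ℝ] ℝ)) (hG' : ∀ j : ℕ, HasFDerivAt G (G' j) (u j))
    (F' : ℕ → (V →L[ℝ] ℝ)) (hF' : ∀ j : ℕ, 1 ≤ j → HasFDerivAt F (F' j) (u j))
    (hopt : ∀ j : ℕ, 1 ≤ j → ∀ h ∈ W, (G' j - G' (j - 1)) h = -(α j) * F' j h) :
    ∀ w : V, w - u 0 ∈ W → ∀ k : ℕ, 1 ≤ k →
      bregmanDiv G w (u k) (G' k)
        + (∑ j ∈ Finset.Icc 1 k, bregmanDiv G (u j) (u (j - 1)) (G' (j - 1)))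
        + (∑ j ∈ Finset.Icc 1 k, α j * (F (u j) - F w))
      ≤ bregmanDiv G w (u 0) (G' 0) := by
  intro w hw k hk
  clear hk
  induction k with
  | zero => simp
  | succ n ih =>
    rw [Finset.sum_Icc_succ_top (by omega), Finset.sum_Icc_succ_top (by omega)]
    have hn : 1 ≤ n + 1 := by omega
    have hmem : w - u (n + 1) ∈ W := by
      have := W.sub_mem hw (hu (n + 1))
      simpa using this
    have h1 := hopt (n + 1) hn _ hmem
    have h2 := mul_le_mul_of_nonneg_left
      (convex_gradient_ineq hF (hF' (n + 1) hn) w) (hα (n + 1) hn).le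
    simp only [Nat.add_sub_cancel, ContinuousLinearMap.sub_apply, bregmanDiv, map_sub] at *
    linarith
end
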